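/- (Dispersive estimate) Let $2<q\le\infty$ and let $q'$ be the conjugate exponent ($\frac1q+\frac1{q'}=1$). There exists a constant $C>0$ such that for every $t\in\mathbb{R}$ and every $f\in L^{q'}(\mathbb{T})$: $\|e^{it\mathcal{L}}f\|_{L^q(\mathbb{T})}\le C\,\|f\|_{L^{q'}(\mathbb{T})}$ if $|t|<1$, and $\|e^{it\mathcal{L}}f\|_{L^q(\mathbb{T})}\le C\,|t|^{-3/2}\,\|f\|_{L^{q'}(\mathbb{T})}$ if $|t|\ge1$. -/

import Mathlib

noncomputable section

open Complex MeasureTheory Filter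
open scoped ENNReal NNReal Topology

/-- A homogeneous tree of degree `Q+1`: a connected acyclic graph in which every
vertex has exactly `Q+1` neighbours. -/
structure HomTree (Q : ℕ) : Type 1 where
  V : Type
  graph : SimpleGraph V
  isTree : graph.IsTree
  regular : ∀ x : V, {y : V | graph.Adj x y}.ncard = Q + 1

/-- `γ(0) = 2/(Q^{1/2} + Q^{-1/2})`. -/
def gammaZero (Q : ℕ) : ℝ := 2 / (Real.sqrt Q + (Real.sqrt Q)⁻¹)

/-- The radial Schrödinger kernel
`s_t(n) = e^{it} (2/π) ∑_{k≥0} Q^{-n/2-k} ∫₀^π e^{-iγ(0)t cos λ} sin λ sin((n+2k+1)λ) dλ`. -/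
def schKernel (Q : ℕ) (t : ℝ) (n : ℕ) : ℂ :=
  Complex.exp (Complex.I * t) * (2 / Real.pi) *
    ∑' k : ℕ, (((Q : ℝ) ^ (-(n : ℝ) / 2 - (k : ℝ)) : ℝ) : ℂ) *
      ∫ l in (0 : ℝ)..Real.pi,
        Complex.exp (-Complex.I * (gammaZero Q) * t * Real.cos l) *
          (Real.sin l : ℂ) * (Real.sin (((n : ℝ) + 2 * k + 1) * l) : ℂ)

/-- The sum of `g` over the sphere of radius `n` centred at `x`. -/
def sphereSum {Q : ℕ} (T : HomTree Q) (g : T.V → ℂ) (x : T.V) (n : ℕ) : ℂ :=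
  ∑' y : {y : T.V // T.graph.dist x y = n}, g y

/-- The Schrödinger propagator `e^{itℒ}`, realised (and extended to all
`L^p` spaces) as convolution with the radial kernel `s_t`:
`e^{itℒ}g(x) = ∑_{n≥0} s_t(n) ∑_{d(x,y)=n} g(y)`. -/
def propagate {Q : ℕ} (T : HomTree Q) (t : ℝ) (g : T.V → ℂ) (x : T.V) : ℂ :=
  ∑' n : ℕ, schKernel Q t n * sphereSum T g x n

/-- The `L^q(𝕋)` norm (with the counting measure), valued in `ℝ≥0∞`, for an
exponent `q : ℝ≥0∞`. -/
def spaceNorm {Q : ℕ} (T : HomTree Q) (q : ℝ≥0∞) (g : T.V → ℂ) : ℝ≥0∞ :=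
  if q = ∞ then ⨆ x : T.V, (‖g x‖₊ : ℝ≥0∞)
  else (∑' x : T.V, (‖g x‖₊ : ℝ≥0∞) ^ q.toReal) ^ (1 / q.toReal)

/-- Every tree carries a parent map, pointing towards a chosen root: each edge joins a vertex
to its parent. -/
lemma exists_parent {V : Type*} {G : SimpleGraph V} (hG : G.IsTree) :
    ∃ p : V → V, (∀ x, p x = x ∨ G.Adj x (p x)) ∧ ∀ x y, G.Adj x y → p x = y ∨ p y = x := by
  obtain ⟨o⟩ := hG.connected.nonempty
  choose w hw _ using fun x => hG.existsUnique_path x o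
  refine ⟨fun x => (w x).snd, fun x => ?_, fun x y hxy => ?_⟩
  · by_cases hn : (w x).Nil
    · left
      have hx : x = o := hn.eq
      have h0 := SimpleGraph.Walk.length_eq_zero_iff.mpr hn
      have : (w x).getVert 1 = o := SimpleGraph.Walk.getVert_of_length_le _ (by omega)
      exact this.trans hx.symm
    · exact Or.inr ((w x).adj_snd hn)
  · by_cases hy : y ∈ (w x).support
    · exact Or.inl (hG.isAcyclic.eq_snd_of_adj_start (hw x) hxy hy).symm
    · right
      have hx : x ∈ (w y).support := by
        have := hG.isAcyclic.mem_support_of_ne_mem_support_of_adj_of_isPath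
          (hw y).reverse (hw x).reverse hxy.symm (by simpa using hy)
        simpa using this
      exact (hG.isAcyclic.eq_snd_of_adj_start (hw y) hxy.symm hx).symm

lemma dist_iterate_parent_le {V : Type*} {G : SimpleGraph V} (hG : G.Connected) {p : V → V}
    (hp : ∀ x, p x = x ∨ G.Adj x (p x)) (i : ℕ) (x : V) : G.dist x (p^[i] x) ≤ i := by
  induction i with
  | zero => simp
  | succ i ih =>
    rw [Function.iterate_succ_apply']
    have h1 : G.dist (p^[i] x) (p (p^[i] x)) ≤ 1 := by
      rcases hp (p^[i] x) with h | h
      · simp [h]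
      · exact (SimpleGraph.dist_eq_one_iff_adj.mpr h).le
    have := hG.dist_triangle (u := x) (v := p^[i] x) (w := p (p^[i] x))
    omega

lemma exists_common_ancestor {V : Type*} {G : SimpleGraph V} {p : V → V}
    (hp : ∀ x y, G.Adj x y → p x = y ∨ p y = x) {x y : V} (w : G.Walk x y) :
    ∃ i j, i + j ≤ w.length ∧ p^[i] x = p^[j] y := by
  induction w with
  | nil => exact ⟨0, 0, by simp, rfl⟩
  | @cons x z y h w ih =>
    obtain ⟨i, j, hij, hz⟩ := ih
    rw [SimpleGraph.Walk.length_cons]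
    rcases hp x z h with hx | hx
    · exact ⟨i + 1, j, by omega, by rw [Function.iterate_succ_apply, hx, hz]⟩
    · cases i with
      | zero =>
        refine ⟨0, j + 1, by omega, ?_⟩
        rw [Function.iterate_succ_apply', ← hz]
        simpa using hx.symm
      | succ i =>
        refine ⟨i, j, by omega, ?_⟩
        rw [← hz, Function.iterate_succ_apply, hx]

/-- The two arms of the geodesic from `x` to `y` have lengths `i` and `j` and meet at a common
ancestor. -/
lemma exists_meet {V : Type*} {G : SimpleGraph V} (hG : G.Connected) {p : V → V}
    (hp₁ : ∀ x, p x = x ∨ G.Adj x (p x)) (hp₂ : ∀ x y, G.Adj x y → p x = y ∨ p y = x) (x y : V) :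
    ∃ i j, i + j = G.dist x y ∧ p^[i] x = p^[j] y ∧ G.dist (p^[i] x) x = i ∧
      G.dist (p^[j] y) y = j := by
  obtain ⟨w, hw⟩ := hG.exists_walk_length_eq_dist x y
  obtain ⟨i, j, hij, hm⟩ := exists_common_ancestor hp₂ w
  have h1 := dist_iterate_parent_le hG hp₁ i x
  have h2 := dist_iterate_parent_le hG hp₁ j y
  have h3 := hG.dist_triangle (u := x) (v := p^[i] x) (w := y)
  rw [G.dist_comm] at h2
  rw [← hm] at h2
  refine ⟨i, j, by omega, hm, ?_, ?_⟩
  · rw [G.dist_comm]; omega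
  · rw [← hm]; omega

lemma tsum_ite_eq_encard {α : Type*} (P : α → Prop) [DecidablePred P] :
    (∑' y, if P y then (1 : ℝ≥0∞) else 0) = ({y | P y}.encard : ℝ≥0∞) := by
  rw [← ENNReal.tsum_set_one, tsum_subtype {y | P y} fun _ => (1 : ℝ≥0∞)]
  simp only [Set.indicator_apply, Set.mem_ofPred_eq]

open Classical in
/-- Spheres in a homogeneous tree grow at most like `Q ^ n`. -/
lemma tsum_sphere_le {Q : ℕ} (hQ : 2 ≤ Q) (T : HomTree Q) (x : T.V) (n : ℕ) :
    (∑' y, if T.graph.dist x y = n then (1 : ℝ≥0∞) else 0) ≤ 2 * (Q : ℝ≥0∞) ^ n := by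
  have hfin : ∀ z : T.V, {y | T.graph.Adj z y}.Finite := fun z =>
    Set.finite_of_ncard_ne_zero (by rw [T.regular]; omega)
  have hconn := T.isTree.connected
  have step : ∀ n (c : ℕ), (∀ z, T.graph.dist x z = n →
        {y | T.graph.Adj z y ∧ T.graph.dist x y = n + 1}.encard ≤ c) →
      (∑' y, if T.graph.dist x y = n + 1 then (1 : ℝ≥0∞) else 0) ≤
        c * ∑' z, if T.graph.dist x z = n then (1 : ℝ≥0∞) else 0 := by
    intro n c hc
    calc (∑' y, if T.graph.dist x y = n + 1 then (1 : ℝ≥0∞) else 0)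
        ≤ ∑' y, ∑' z, if T.graph.dist x z = n ∧ T.graph.Adj z y ∧ T.graph.dist x y = n + 1
            then (1 : ℝ≥0∞) else 0 := by
          refine ENNReal.tsum_le_tsum fun y => ?_
          split_ifs with hy
          · obtain ⟨w, hw⟩ := hconn.exists_walk_length_eq_dist x y
            have hnil : ¬ w.Nil := by
              rw [← SimpleGraph.Walk.length_eq_zero_iff]; omega
            have hadj := w.adj_penultimate hnil
            have hd : T.graph.dist x w.penultimate = n := by
              have h1 := SimpleGraph.dist_le w.dropLast
              have h2 := hconn.dist_triangle (u := x) (v := w.penultimate) (w := y)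
              rw [SimpleGraph.dist_eq_one_iff_adj.mpr hadj] at h2
              have h3 : w.dropLast.length + 1 = w.length :=
                SimpleGraph.Walk.length_dropLast_add_one hnil
              omega
            refine le_trans ?_ (ENNReal.le_tsum w.penultimate)
            rw [if_pos ⟨hd, hadj, hy⟩]
          · exact zero_le
      _ = ∑' z, ∑' y, if T.graph.dist x z = n ∧ T.graph.Adj z y ∧ T.graph.dist x y = n + 1
            then (1 : ℝ≥0∞) else 0 := ENNReal.tsum_comm
      _ ≤ ∑' z, c * (if T.graph.dist x z = n then (1 : ℝ≥0∞) else 0) := by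
          refine ENNReal.tsum_le_tsum fun z => ?_
          by_cases hz : T.graph.dist x z = n
          · simp only [hz, true_and, if_true, mul_one]
            rw [tsum_ite_eq_encard]
            exact_mod_cast hc z hz
          · simp [hz]
      _ = _ := ENNReal.tsum_mul_left
  have hpos : ∀ n, (∑' y, if T.graph.dist x y = n + 1 then (1 : ℝ≥0∞) else 0) ≤
      (Q + 1) * (Q : ℝ≥0∞) ^ n := by
    intro n
    induction n with
    | zero =>
      refine (step 0 (Q + 1) fun z _ => ?_).trans ?_
      · refine (Set.encard_le_encard (t := {y | T.graph.Adj z y}) fun y hy => hy.1).trans ?_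
        rw [← (hfin z).cast_ncard_eq, T.regular]
      · have : (∑' z, if T.graph.dist x z = 0 then (1 : ℝ≥0∞) else 0) = 1 := by
          rw [tsum_eq_single x]
          · simp
          · intro b hb
            rw [if_neg]
            rw [hconn.dist_eq_zero_iff]
            exact hb.symm
        rw [this]
        simp
    | succ n ih =>
      refine (step (n + 1) Q fun z hz => ?_).trans ?_
      · obtain ⟨w, hw⟩ := hconn.exists_walk_length_eq_dist x z
        have hnil : ¬ w.Nil := by
          rw [← SimpleGraph.Walk.length_eq_zero_iff]; omega
        have hadj := w.adj_penultimate hnil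
        have hd : T.graph.dist x w.penultimate ≤ n := by
          have h1 := SimpleGraph.dist_le w.dropLast
          have h3 : w.dropLast.length + 1 = w.length :=
            SimpleGraph.Walk.length_dropLast_add_one hnil
          omega
        have hsub : {y | T.graph.Adj z y ∧ T.graph.dist x y = n + 1 + 1} ⊆
            {y | T.graph.Adj z y} \ {w.penultimate} := by
          rintro y ⟨hy1, hy2⟩
          refine ⟨hy1, fun h => ?_⟩
          rw [Set.mem_singleton_iff.mp h] at hy2
          omega
        refine (Set.encard_le_encard hsub).trans ?_
        have hm : w.penultimate ∈ {y | T.graph.Adj z y} := hadj.symm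
        rw [← ((hfin z).subset Set.sdiff_subset).cast_ncard_eq,
          Set.ncard_sdiff_singleton_of_mem hm, T.regular]
        simp
      · calc (Q : ℝ≥0∞) * _ ≤ Q * ((Q + 1) * (Q : ℝ≥0∞) ^ n) := by gcongr
          _ = _ := by ring
  cases n with
  | zero =>
    have : (∑' z, if T.graph.dist x z = 0 then (1 : ℝ≥0∞) else 0) = 1 := by
      rw [tsum_eq_single x]
      · simp
      · intro b hb
        rw [if_neg]
        rw [hconn.dist_eq_zero_iff]
        exact hb.symm
    rw [this]; simp
  | succ n =>
    refine (hpos n).trans ?_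
    have : ((Q : ℝ≥0∞) + 1) ≤ 2 * Q := by
      have : Q + 1 ≤ 2 * Q := by omega
      exact_mod_cast this
    calc _ ≤ 2 * Q * (Q : ℝ≥0∞) ^ n := by gcongr
      _ = _ := by ring

lemma tsum_mul_le_Lp_mul_Lq {α : Type*} {p q : ℝ} (hpq : p.HolderConjugate q) (f g : α → ℝ≥0∞) :
    ∑' a, f a * g a ≤ (∑' a, f a ^ p) ^ (1 / p) * (∑' a, g a ^ q) ^ (1 / q) := by
  let _ : MeasurableSpace α := ⊤
  simpa [lintegral_count] using
    ENNReal.lintegral_mul_le_Lp_mul_Lq (Measure.count : Measure α) hpq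
      (f := f) (g := g) (Measurable.aemeasurable fun _ _ => trivial)
      (Measurable.aemeasurable fun _ _ => trivial)

/-- Weighted Cauchy–Schwarz inequality. -/
lemma sq_tsum_mul_le {α : Type*} (w u v b : α → ℝ≥0∞) (huv : ∀ a, u a * v a = 1) :
    (∑' a, w a * b a) ^ 2 ≤ (∑' a, w a * u a) * ∑' a, w a * v a * b a ^ 2 := by
  have h := tsum_mul_le_Lp_mul_Lq Real.HolderConjugate.two_two
    (fun a => (w a * u a) ^ (1 / 2 : ℝ)) (fun a => (w a * v a) ^ (1 / 2 : ℝ) * b a)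
  have e1 : ∀ a, (w a * u a) ^ (1 / 2 : ℝ) * ((w a * v a) ^ (1 / 2 : ℝ) * b a) = w a * b a := by
    intro a
    rw [← mul_assoc, ← ENNReal.mul_rpow_of_nonneg _ _ (by norm_num)]
    have : w a * u a * (w a * v a) = w a ^ (2 : ℝ) := by
      rw [ENNReal.rpow_two]
      calc _ = w a ^ 2 * (u a * v a) := by ring
        _ = _ := by rw [huv, mul_one]
    rw [this, ← ENNReal.rpow_mul]
    norm_num
  have e2 : ∀ a, ((w a * u a) ^ (1 / 2 : ℝ)) ^ (2 : ℝ) = w a * u a := by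
    intro a; rw [← ENNReal.rpow_mul]; norm_num
  have e3 : ∀ a, ((w a * v a) ^ (1 / 2 : ℝ) * b a) ^ (2 : ℝ) = w a * v a * b a ^ 2 := by
    intro a
    rw [ENNReal.mul_rpow_of_nonneg _ _ (by norm_num), ← ENNReal.rpow_mul]
    norm_num
  simp only [e1, e2, e3] at h
  calc _ ≤ _ := pow_le_pow_left₀ zero_le h 2
    _ = _ := by
      rw [mul_pow, ← ENNReal.rpow_natCast, ← ENNReal.rpow_natCast, ← ENNReal.rpow_mul,
        ← ENNReal.rpow_mul]
      norm_num

/-- The Schur-type constant controlling the radial kernel `κ` on `ℓ²` of the tree. -/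
def schurConst (Q : ℕ) (κ : ℕ → ℝ≥0∞) : ℝ≥0∞ :=
  ∑' z : ℕ × ℕ, κ (z.1 + z.2) * (2 * ENNReal.ofReal (Real.sqrt Q) ^ (z.1 + z.2))

open Classical in
/-- `ℓ²` boundedness of convolution with a nonnegative radial kernel. -/
lemma tsum_sq_radial_le {Q : ℕ} (hQ : 2 ≤ Q) (T : HomTree Q) (κ : ℕ → ℝ≥0∞) (b : T.V → ℝ≥0∞) :
    ∑' x, (∑' y, κ (T.graph.dist x y) * b y) ^ 2 ≤ schurConst Q κ ^ 2 * ∑' y, b y ^ 2 := by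
  obtain ⟨p, hp₁, hp₂⟩ := exists_parent T.isTree
  have hconn := T.isTree.connected
  set r : ℝ≥0∞ := ENNReal.ofReal (Real.sqrt Q) with hr
  have hQ0 : (0 : ℝ) < Q := by positivity
  have hr0 : r ≠ 0 := by simpa [hr] using hQ0
  have hrt : r ≠ ∞ := ENNReal.ofReal_ne_top
  have hrQ : (Q : ℝ≥0∞) = r * r := by
    rw [hr, ← ENNReal.ofReal_mul (Real.sqrt_nonneg _), Real.mul_self_sqrt hQ0.le,
      ENNReal.ofReal_natCast]
  have hinv : r⁻¹ * r = 1 := ENNReal.inv_mul_cancel hr0 hrt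
  have hpow : ∀ i j : ℕ, r ^ i * r⁻¹ ^ j * (2 * (Q : ℝ≥0∞) ^ j) = 2 * r ^ (i + j) := by
    intro i j
    rw [hrQ, mul_pow, pow_add]
    calc _ = 2 * (r ^ i * r ^ j) * (r⁻¹ ^ j * r ^ j) := by ring
      _ = _ := by rw [← mul_pow, hinv]; simp
  let L : ℕ → ℕ → T.V → T.V → ℝ≥0∞ := fun i j x y =>
    if p^[i] x = p^[j] y ∧ T.graph.dist (p^[i] x) x = i ∧ T.graph.dist (p^[j] y) y = j
    then 1 else 0
  have hLrow : ∀ i j x, ∑' y, L i j x y ≤ 2 * (Q : ℝ≥0∞) ^ j := by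
    intro i j x
    refine le_trans (ENNReal.tsum_le_tsum fun y => ?_) (tsum_sphere_le hQ T (p^[i] x) j)
    simp only [L]
    split_ifs with h h'
    · exact le_rfl
    · exact absurd (h.1 ▸ h.2.2) h'
    all_goals exact zero_le
  have hLcol : ∀ i j y, ∑' x, L i j x y ≤ 2 * (Q : ℝ≥0∞) ^ i := by
    intro i j y
    refine le_trans (ENNReal.tsum_le_tsum fun x => ?_) (tsum_sphere_le hQ T (p^[j] y) i)
    simp only [L]
    split_ifs with h h'
    · exact le_rfl
    · exact absurd (h.1 ▸ h.2.1) h'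
    all_goals exact zero_le
  let w : T.V → (ℕ × ℕ) × T.V → ℝ≥0∞ := fun x z => κ (z.1.1 + z.1.2) * L z.1.1 z.1.2 x z.2
  let u : (ℕ × ℕ) × T.V → ℝ≥0∞ := fun z => r ^ z.1.1 * r⁻¹ ^ z.1.2
  let v : (ℕ × ℕ) × T.V → ℝ≥0∞ := fun z => r ^ z.1.2 * r⁻¹ ^ z.1.1
  have huv : ∀ z, u z * v z = 1 := by
    intro z
    calc u z * v z = (r⁻¹ * r) ^ z.1.1 * (r⁻¹ * r) ^ z.1.2 := by simp only [u, v]; ring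
      _ = 1 := by simp [hinv]
  have hker : ∀ x, ∑' y, κ (T.graph.dist x y) * b y ≤ ∑' z, w x z * b z.2 := by
    intro x
    rw [ENNReal.tsum_prod', ENNReal.tsum_comm]
    refine ENNReal.tsum_le_tsum fun y => ?_
    obtain ⟨i, j, hij, hm⟩ := exists_meet hconn hp₁ hp₂ x y
    refine le_trans ?_ (ENNReal.le_tsum (i, j))
    simp only [w, L, if_pos hm, hij, mul_one, le_refl]
  have hrow : ∀ x, ∑' z, w x z * u z ≤ schurConst Q κ := by
    intro x
    rw [ENNReal.tsum_prod', schurConst]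
    refine ENNReal.tsum_le_tsum fun ij => ?_
    calc ∑' y, w x (ij, y) * u (ij, y)
        = κ (ij.1 + ij.2) * (r ^ ij.1 * r⁻¹ ^ ij.2) * ∑' y, L ij.1 ij.2 x y := by
          rw [← ENNReal.tsum_mul_left]
          exact tsum_congr fun y => by simp only [w, u]; ring
      _ ≤ κ (ij.1 + ij.2) * (r ^ ij.1 * r⁻¹ ^ ij.2) * (2 * (Q : ℝ≥0∞) ^ ij.2) := by
          gcongr; exact hLrow _ _ _
      _ = _ := by rw [mul_assoc, hpow]
  have hcol : ∀ y, ∑' ij : ℕ × ℕ, ∑' x, w x (ij, y) * v (ij, y) ≤ schurConst Q κ := by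
    intro y
    rw [schurConst]
    refine ENNReal.tsum_le_tsum fun ij => ?_
    calc ∑' x, w x (ij, y) * v (ij, y)
        = κ (ij.1 + ij.2) * (r ^ ij.2 * r⁻¹ ^ ij.1) * ∑' x, L ij.1 ij.2 x y := by
          rw [← ENNReal.tsum_mul_left]
          exact tsum_congr fun y => by simp only [w, v]; ring
      _ ≤ κ (ij.1 + ij.2) * (r ^ ij.2 * r⁻¹ ^ ij.1) * (2 * (Q : ℝ≥0∞) ^ ij.1) := by
          gcongr; exact hLcol _ _ _
      _ = _ := by rw [mul_assoc, hpow, add_comm ij.2]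
  calc ∑' x, (∑' y, κ (T.graph.dist x y) * b y) ^ 2
      ≤ ∑' x, schurConst Q κ * ∑' z, w x z * v z * b z.2 ^ 2 := by
        refine ENNReal.tsum_le_tsum fun x => ?_
        calc _ ≤ (∑' z, w x z * b z.2) ^ 2 := pow_le_pow_left₀ zero_le (hker x) 2
          _ ≤ _ := sq_tsum_mul_le (w x) u v (fun z => b z.2) huv
          _ ≤ _ := by gcongr; exact hrow x
    _ = schurConst Q κ * ∑' y, (∑' ij : ℕ × ℕ, ∑' x, w x (ij, y) * v (ij, y)) * b y ^ 2 := by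
        rw [ENNReal.tsum_mul_left, ENNReal.tsum_comm, ENNReal.tsum_prod', ENNReal.tsum_comm]
        simp only [ENNReal.tsum_mul_right]
    _ ≤ schurConst Q κ * ∑' y, schurConst Q κ * b y ^ 2 := by
        gcongr with y; exact hcol y
    _ = _ := by rw [ENNReal.tsum_mul_left]; ring

/-- Kunze–Stein type estimate `ℓ^{q'} → ℓ^q` for a nonnegative radial kernel. -/
lemma tsum_rpow_radial_le {Q : ℕ} (hQ : 2 ≤ Q) (T : HomTree Q) {q q' : ℝ} (hq : 2 < q)
    (hqq : q.HolderConjugate q') (k : ℕ → ℝ≥0∞) (f : T.V → ℝ≥0∞) :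
    (∑' x, (∑' y, k (T.graph.dist x y) * f y) ^ q) ^ (1 / q) ≤
      (schurConst Q fun n => k n ^ (q / 2)) ^ (2 / q) * (∑' y, f y ^ q') ^ (1 / q') := by
  have hq0 : 0 < q := by linarith
  have hq'0 : 0 < q' := hqq.symm.pos
  have hq' : q' = q / (q - 1) := hqq.conjugate_eq
  have h1 : q - 1 ≠ 0 := by linarith
  have h2 : q - 2 ≠ 0 := by linarith
  have h2' : 0 < q - 2 := by linarith
  set F := ∑' y, f y ^ q' with hF
  set M := schurConst Q fun n => k n ^ (q / 2) with hM
  have hconj : (q / (q - 2)).HolderConjugate (q / 2) := by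
    rw [Real.holderConjugate_iff]
    refine ⟨by rw [lt_div_iff₀ h2']; linarith, by field_simp; ring⟩
  have hpt : ∀ x, (∑' y, k (T.graph.dist x y) * f y) ^ q ≤
      F ^ (q - 2) * (∑' y, k (T.graph.dist x y) ^ (q / 2) * f y ^ (q' / 2)) ^ 2 := by
    intro x
    have h := tsum_mul_le_Lp_mul_Lq hconj (fun y => f y ^ (q' * (q - 2) / q))
      (fun y => k (T.graph.dist x y) * f y ^ (q' / q))
    have e1 : ∀ y, f y ^ (q' * (q - 2) / q) * (k (T.graph.dist x y) * f y ^ (q' / q)) =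
        k (T.graph.dist x y) * f y := by
      intro y
      rw [mul_left_comm, ← ENNReal.rpow_add_of_nonneg _ _ (by positivity) (by positivity)]
      have : q' * (q - 2) / q + q' / q = 1 := by rw [hq']; field_simp; ring
      rw [this, ENNReal.rpow_one]
    have e2 : ∀ y, (f y ^ (q' * (q - 2) / q)) ^ (q / (q - 2)) = f y ^ q' := by
      intro y; rw [← ENNReal.rpow_mul]; congr 1; field_simp
    have e3 : ∀ y, (k (T.graph.dist x y) * f y ^ (q' / q)) ^ (q / 2) =
        k (T.graph.dist x y) ^ (q / 2) * f y ^ (q' / 2) := by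
      intro y
      rw [ENNReal.mul_rpow_of_nonneg _ _ (by positivity), ← ENNReal.rpow_mul]
      congr 2; field_simp
    simp only [e1, e2, e3] at h
    refine (ENNReal.rpow_le_rpow h hq0.le).trans_eq ?_
    rw [ENNReal.mul_rpow_of_nonneg _ _ hq0.le, ← ENNReal.rpow_mul, ← ENNReal.rpow_mul,
      ← ENNReal.rpow_two]
    congr 2 <;> field_simp
  have hb : ∑' y, (f y ^ (q' / 2)) ^ 2 = F := by
    refine tsum_congr fun y => ?_
    rw [← ENNReal.rpow_two, ← ENNReal.rpow_mul]; congr 1; ring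
  have hsum : ∑' x, (∑' y, k (T.graph.dist x y) * f y) ^ q ≤ M ^ 2 * F ^ (q - 1) := by
    calc _ ≤ ∑' x, F ^ (q - 2) *
          (∑' y, k (T.graph.dist x y) ^ (q / 2) * f y ^ (q' / 2)) ^ 2 := ENNReal.tsum_le_tsum hpt
      _ ≤ F ^ (q - 2) * (M ^ 2 * F) := by
        rw [ENNReal.tsum_mul_left, ← hb]
        gcongr
        exact tsum_sq_radial_le hQ T (fun n => k n ^ (q / 2)) fun y => f y ^ (q' / 2)
      _ = M ^ 2 * (F ^ (q - 2) * F ^ (1 : ℝ)) := by rw [ENNReal.rpow_one]; ring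
      _ = _ := by
        rw [← ENNReal.rpow_add_of_nonneg _ _ h2'.le zero_le_one]; congr 2; ring
  refine (ENNReal.rpow_le_rpow hsum (by positivity)).trans_eq ?_
  rw [ENNReal.mul_rpow_of_nonneg _ _ (by positivity), ← ENNReal.rpow_two, ← ENNReal.rpow_mul,
    ← ENNReal.rpow_mul]
  congr 2
  · ring
  · rw [hq']; field_simp

/-- The radial majorant of the Schrödinger kernel. -/
def radialMajorant (Q : ℕ) (n : ℕ) : ℝ := ((n : ℝ) + 1) ^ 2 * (Real.sqrt Q)⁻¹ ^ n

lemma radialMajorant_nonneg (Q n : ℕ) : 0 ≤ radialMajorant Q n := by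
  unfold radialMajorant; positivity

lemma summable_add_one_rpow_mul_geometric {q ρ : ℝ} (hρ₀ : 0 < ρ) (hρ₁ : ρ < 1) :
    Summable fun i : ℕ => ((i : ℝ) + 1) ^ q * ρ ^ i := by
  have h := (summable_nat_add_iff 1).mpr (summable_pow_mul_geometric_of_norm_lt_one ⌈q⌉₊
    (r := ρ) (by rwa [Real.norm_of_nonneg hρ₀.le]))
  refine Summable.of_nonneg_of_le (fun i => by positivity) (fun i => ?_) (h.mul_left ρ⁻¹)
  have h1 : ((i : ℝ) + 1) ^ q ≤ ((i : ℝ) + 1) ^ ⌈q⌉₊ := by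
    rw [← Real.rpow_natCast]
    exact Real.rpow_le_rpow_of_exponent_le (by linarith [(Nat.cast_nonneg i : (0 : ℝ) ≤ i)])
      (Nat.le_ceil q)
  calc ((i : ℝ) + 1) ^ q * ρ ^ i ≤ ((i : ℝ) + 1) ^ ⌈q⌉₊ * ρ ^ i := by gcongr
    _ = _ := by push_cast; field_simp; ring

lemma schurConst_radialMajorant_ne_top {Q : ℕ} (hQ : 2 ≤ Q) {q : ℝ} (hq : 2 < q) :
    schurConst Q (fun n => ENNReal.ofReal (radialMajorant Q n) ^ (q / 2)) ≠ ∞ := by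
  have hQ1 : 1 < Real.sqrt Q := by
    rw [Real.lt_sqrt zero_le_one]
    exact_mod_cast (by omega : 1 ^ 2 < Q)
  set s := Real.sqrt Q with hs
  have hs0 : 0 < s := by linarith
  set ρ : ℝ := s ^ (1 - q / 2) with hρ
  have hρ₀ : 0 < ρ := Real.rpow_pos_of_pos hs0 _
  have hρ₁ : ρ < 1 := Real.rpow_lt_one_of_one_lt_of_neg hQ1 (by linarith)
  set g : ℕ → ℝ := fun i => ((i : ℝ) + 1) ^ q * ρ ^ i with hg
  have hg0 : ∀ i, 0 ≤ g i := fun i => by simp only [hg]; positivity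
  have hterm : ∀ n : ℕ, radialMajorant Q n ^ (q / 2) * s ^ n = g n := by
    intro n
    have hn : (0 : ℝ) ≤ (n : ℝ) + 1 := by positivity
    rw [radialMajorant, ← hs, Real.mul_rpow (by positivity) (by positivity), hg,
      ← Real.rpow_natCast, ← Real.rpow_mul hn, mul_assoc]
    congr 1
    · congr 1; push_cast; ring
    · rw [hρ, ← Real.rpow_natCast s⁻¹, ← Real.rpow_natCast s, ← Real.rpow_natCast (s ^ (_ : ℝ)),
        ← Real.rpow_mul (by positivity), ← Real.rpow_mul hs0.le, Real.inv_rpow hs0.le,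
        ← Real.rpow_neg hs0.le, ← Real.rpow_add hs0]
      congr 1; ring
  have hmul : ∀ i j : ℕ, g (i + j) ≤ g i * g j := by
    intro i j
    have hi : (0 : ℝ) ≤ i := Nat.cast_nonneg i
    have hj : (0 : ℝ) ≤ j := Nat.cast_nonneg j
    have : ((i + j : ℕ) : ℝ) + 1 ≤ ((i : ℝ) + 1) * ((j : ℝ) + 1) := by
      push_cast; nlinarith
    calc g (i + j) ≤ (((i : ℝ) + 1) * ((j : ℝ) + 1)) ^ q * ρ ^ (i + j) := by
          simp only [hg]; gcongr
      _ = _ := by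
          rw [Real.mul_rpow (by positivity) (by positivity)]; simp only [hg]; ring
  have hle : schurConst Q (fun n => ENNReal.ofReal (radialMajorant Q n) ^ (q / 2)) ≤
      2 * ((∑' i, ENNReal.ofReal (g i)) * ∑' j, ENNReal.ofReal (g j)) := by
    rw [schurConst, ← ENNReal.tsum_mul_right, ← ENNReal.tsum_mul_left, ENNReal.tsum_prod']
    refine ENNReal.tsum_le_tsum fun i => ?_
    rw [← ENNReal.tsum_mul_left, ← ENNReal.tsum_mul_left]
    refine ENNReal.tsum_le_tsum fun j => ?_
    dsimp only
    rw [ENNReal.ofReal_rpow_of_nonneg (radialMajorant_nonneg _ _) (by linarith),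
      ← ENNReal.ofReal_pow hs0.le, mul_left_comm,
      ← ENNReal.ofReal_mul (Real.rpow_nonneg (radialMajorant_nonneg _ _) _), hterm,
      ← ENNReal.ofReal_mul (hg0 _)]
    gcongr
    exact hmul i j
  have hfin : ∑' i, ENNReal.ofReal (g i) ≠ ∞ :=
    (summable_add_one_rpow_mul_geometric hρ₀ hρ₁).tsum_ofReal_ne_top
  exact ne_top_of_le_ne_top
    (ENNReal.mul_ne_top ENNReal.ofNat_ne_top (ENNReal.mul_ne_top hfin hfin)) hle

lemma exists_radialMajorant_le {Q : ℕ} (hQ : 2 ≤ Q) : ∃ B : ℝ, ∀ n, radialMajorant Q n ≤ B := by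
  have hQ1 : 1 < Real.sqrt Q := by
    rw [Real.lt_sqrt zero_le_one]
    exact_mod_cast (by omega : 1 ^ 2 < Q)
  have h := summable_add_one_rpow_mul_geometric (q := 2) (inv_pos.mpr (zero_lt_one.trans hQ1))
    (inv_lt_one_of_one_lt₀ hQ1)
  refine ⟨∑' i : ℕ, ((i : ℝ) + 1) ^ (2 : ℝ) * (Real.sqrt Q)⁻¹ ^ i, fun n => ?_⟩
  have := h.le_tsum n (fun i _ => by positivity)
  simpa [radialMajorant] using this

/-- Van der Corput type bound for the oscillatory integral defining the Bessel functions. -/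
lemma norm_integral_exp_cos_mul_cos_le {τ m : ℝ} (hτ : 1 ≤ |τ|) (hm : 1 ≤ m) :
    ‖∫ l in (0 : ℝ)..Real.pi, Complex.exp (-Complex.I * τ * Real.cos l) *
      (Real.cos (m * l) : ℂ)‖ ≤ 20 * m * |τ| ^ (-(1 / 2) : ℝ) := by
  set F : ℝ → ℂ := fun l => Complex.exp (-Complex.I * τ * Real.cos l) * (Real.cos (m * l) : ℂ)
    with hF
  have hFc : Continuous F := by fun_prop
  have hexp : ∀ l : ℝ, ‖Complex.exp (-Complex.I * τ * Real.cos l)‖ = 1 := by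
    intro l
    have : -Complex.I * τ * Real.cos l = ((-τ * Real.cos l : ℝ) : ℂ) * Complex.I := by
      push_cast; ring
    rw [this, Complex.norm_exp_ofReal_mul_I]
  have hF1 : ∀ l, ‖F l‖ ≤ 1 := by
    intro l
    rw [hF]; simp only [norm_mul, hexp, one_mul, Complex.norm_real]
    exact Real.abs_cos_le_one _
  set δ : ℝ := |τ| ^ (-(1 / 2) : ℝ) with hδ
  have hτ0 : 0 < |τ| := by linarith
  have hτne : τ ≠ 0 := abs_pos.mp hτ0
  have hδ0 : 0 < δ := Real.rpow_pos_of_pos hτ0 _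
  have hδ1 : δ ≤ 1 := Real.rpow_le_one_of_one_le_of_nonpos hτ (by norm_num)
  have hδτ : |τ| * δ * δ = 1 := by
    rw [mul_assoc, hδ, ← Real.rpow_add hτ0]
    norm_num
    rw [Real.rpow_neg_one, mul_inv_cancel₀ hτ0.ne']
  have hpi := Real.pi_gt_three
  have hpi4 := Real.pi_lt_d2
  have hsδ : δ / 2 ≤ Real.sin δ := by
    have := Real.mul_le_sin hδ0.le (by linarith)
    have h2 : (1 : ℝ) / 2 ≤ 2 / Real.pi := by
      rw [div_le_div_iff₀ (by norm_num) Real.pi_pos]; linarith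
    nlinarith
  have hs0 : 0 < Real.sin δ := by linarith
  set σ := Real.sin δ with hσ
  have hle : δ ≤ Real.pi - δ := by linarith
  have hsin : ∀ l ∈ Set.uIcc δ (Real.pi - δ), σ ≤ Real.sin l := by
    intro l hl
    rw [Set.uIcc_of_le hle] at hl
    rcases le_total l (Real.pi / 2) with h | h
    · exact Real.sin_le_sin_of_le_of_le_pi_div_two (by linarith) h hl.1
    · rw [← Real.sin_pi_sub l]
      exact Real.sin_le_sin_of_le_of_le_pi_div_two (by linarith) (by linarith) (by linarith [hl.2])
  have hint : ∀ a b, IntervalIntegrable F volume a b := fun a b => hFc.intervalIntegrable a b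
  have hsplit : ∫ l in (0 : ℝ)..Real.pi, F l = (∫ l in (0 : ℝ)..δ, F l) +
      (∫ l in δ..(Real.pi - δ), F l) + ∫ l in (Real.pi - δ)..Real.pi, F l := by
    rw [intervalIntegral.integral_add_adjacent_intervals (hint _ _) (hint _ _),
      intervalIntegral.integral_add_adjacent_intervals (hint _ _) (hint _ _)]
  have hA : ‖∫ l in (0 : ℝ)..δ, F l‖ ≤ δ := by
    have := intervalIntegral.norm_integral_le_of_norm_le_const (a := 0) (b := δ) (f := F) (C := 1)
      fun l _ => hF1 l
    simpa [abs_of_pos hδ0] using this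
  have hB : ‖∫ l in (Real.pi - δ)..Real.pi, F l‖ ≤ δ := by
    have := intervalIntegral.norm_integral_le_of_norm_le_const (a := Real.pi - δ) (b := Real.pi)
      (f := F) (C := 1) fun l _ => hF1 l
    simpa [abs_of_pos hδ0] using this
  have hC : ‖∫ l in δ..(Real.pi - δ), F l‖ ≤ |τ|⁻¹ * ((4 + 4 * m) / σ) := by
    set E : ℝ → ℂ := fun l => (Complex.I * τ)⁻¹ * Complex.exp (-Complex.I * τ * Real.cos l)
      with hE
    set E' : ℝ → ℂ := fun l => Complex.exp (-Complex.I * τ * Real.cos l) * Real.sin l with hE'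
    set g : ℝ → ℝ := fun l => Real.cos (m * l) / Real.sin l with hg
    set g' : ℝ → ℝ := fun l =>
      (-(m * Real.sin (m * l)) * Real.sin l - Real.cos (m * l) * Real.cos l) / Real.sin l ^ 2
      with hg'
    have hEn : ∀ l, ‖E l‖ = |τ|⁻¹ := by
      intro l; rw [hE]; simp only [norm_mul, hexp, norm_inv]; simp
    have hEd : ∀ l ∈ Set.uIcc δ (Real.pi - δ), HasDerivAt E (E' l) l := by
      intro l _
      have h1 : HasDerivAt (fun l : ℝ => (Real.cos l : ℂ)) ((-Real.sin l : ℝ) : ℂ) l :=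
        (Real.hasDerivAt_cos l).ofReal_comp
      have h2 := ((h1.const_mul (-Complex.I * (τ : ℂ))).cexp).const_mul (Complex.I * (τ : ℂ))⁻¹
      refine h2.congr_deriv ?_
      simp only [hE']
      have hτC : (τ : ℂ) ≠ 0 := Complex.ofReal_ne_zero.mpr hτne
      push_cast
      field_simp [hτC]
    have hgd : ∀ l ∈ Set.uIcc δ (Real.pi - δ),
        HasDerivAt (fun l => (g l : ℂ)) ((g' l : ℝ) : ℂ) l := by
      intro l hl
      have hsl : Real.sin l ≠ 0 := (hs0.trans_le (hsin l hl)).ne'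
      have h1 : HasDerivAt (fun l : ℝ => Real.cos (m * l)) (-(m * Real.sin (m * l))) l := by
        have := ((hasDerivAt_id l).const_mul m).cos
        refine this.congr_deriv ?_
        simp; ring
      exact (h1.div (Real.hasDerivAt_sin l) hsl).ofReal_comp
    have hsc : ∀ l ∈ Set.uIcc δ (Real.pi - δ), Real.sin l ^ 2 ≠ 0 := fun l hl =>
      pow_ne_zero 2 (hs0.trans_le (hsin l hl)).ne'
    have hg'c : ContinuousOn g' (Set.uIcc δ (Real.pi - δ)) :=
      ContinuousOn.div (by fun_prop) (by fun_prop) hsc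
    have hg'i : IntervalIntegrable (fun l => ((g' l : ℝ) : ℂ)) volume δ (Real.pi - δ) :=
      (Complex.continuous_ofReal.comp_continuousOn hg'c).intervalIntegrable
    have hE'i : IntervalIntegrable E' volume δ (Real.pi - δ) := by
      apply Continuous.intervalIntegrable; fun_prop
    have hparts := intervalIntegral.integral_mul_deriv_eq_deriv_mul hgd hEd hg'i hE'i
    have heq : ∫ l in δ..(Real.pi - δ), F l = ∫ l in δ..(Real.pi - δ), (g l : ℂ) * E' l := by
      refine intervalIntegral.integral_congr fun l hl => ?_
      have hsl : (Real.sin l : ℂ) ≠ 0 :=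
        Complex.ofReal_ne_zero.mpr (hs0.trans_le (hsin l hl)).ne'
      simp only [hF, hg, hE']
      push_cast at hsl ⊢
      field_simp
    have hgb : ∀ l ∈ Set.uIcc δ (Real.pi - δ), ‖(g l : ℂ) * E l‖ ≤ |τ|⁻¹ * (1 / σ) := by
      intro l hl
      rw [norm_mul, hEn, mul_comm, Complex.norm_real, hg, Real.norm_eq_abs, abs_div,
        abs_of_pos (hs0.trans_le (hsin l hl))]
      gcongr
      · exact Real.abs_cos_le_one _
      · exact hsin l hl
    have hcot : ∀ l ∈ Set.uIcc δ (Real.pi - δ),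
        HasDerivAt (fun l => m / σ * l - Real.cos l / Real.sin l)
          (m / σ + 1 / Real.sin l ^ 2) l := by
      intro l hl
      have hsl : Real.sin l ≠ 0 := (hs0.trans_le (hsin l hl)).ne'
      refine (((hasDerivAt_id l).const_mul (m / σ)).sub
        ((Real.hasDerivAt_cos l).div (Real.hasDerivAt_sin l) hsl)).congr_deriv ?_
      have := Real.sin_sq_add_cos_sq l
      field_simp
      nlinarith
    have hcoti : IntervalIntegrable (fun l => m / σ + 1 / Real.sin l ^ 2) volume δ
        (Real.pi - δ) :=
      (continuousOn_const.add
        (ContinuousOn.div continuousOn_const (by fun_prop) hsc)).intervalIntegrable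
    have hI : ‖∫ l in δ..(Real.pi - δ), ((g' l : ℝ) : ℂ) * E l‖ ≤
        |τ|⁻¹ * ((2 + 4 * m) / σ) := by
      have hb := intervalIntegral.norm_integral_le_of_norm_le hle (μ := volume)
        (f := fun l => ((g' l : ℝ) : ℂ) * E l)
        (g := fun l => |τ|⁻¹ * (m / σ + 1 / Real.sin l ^ 2))
        (Filter.Eventually.of_forall fun l hl => by
          have hl' : l ∈ Set.uIcc δ (Real.pi - δ) := by
            rw [Set.uIcc_of_le hle]; exact Set.Ioc_subset_Icc_self hl
          have hsl := hsin l hl'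
          have hsl0 := hs0.trans_le hsl
          rw [norm_mul, hEn, mul_comm, Complex.norm_real]
          gcongr
          have : g' l = -(m * Real.sin (m * l)) / Real.sin l -
              Real.cos (m * l) * Real.cos l / Real.sin l ^ 2 := by
            simp only [hg']; field_simp
          rw [this]
          refine (norm_sub_le _ _).trans (add_le_add ?_ ?_)
          · rw [Real.norm_eq_abs, abs_div, abs_of_pos hsl0, abs_neg, abs_mul,
              abs_of_nonneg (by linarith : 0 ≤ m)]
            have := Real.abs_sin_le_one (m * l)
            gcongr
            nlinarith
          · rw [Real.norm_eq_abs, abs_div, abs_of_pos (pow_pos hsl0 2), abs_mul]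
            gcongr
            exact mul_le_one₀ (Real.abs_cos_le_one _) (abs_nonneg _) (Real.abs_cos_le_one _))
        (hcoti.const_mul _)
      refine hb.trans ?_
      rw [intervalIntegral.integral_const_mul,
        intervalIntegral.integral_eq_sub_of_hasDerivAt hcot hcoti, Real.cos_pi_sub,
        Real.sin_pi_sub]
      gcongr
      rw [← hσ]
      have hc := Real.cos_le_one δ
      have : m / σ * (Real.pi - δ) - -Real.cos δ / σ - (m / σ * δ - Real.cos δ / σ) =
          (m * (Real.pi - 2 * δ) + 2 * Real.cos δ) / σ := by field_simp; ring
      rw [this]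
      refine div_le_div_of_nonneg_right ?_ hs0.le
      nlinarith
    rw [heq, hparts]
    refine (norm_sub_le _ _).trans ?_
    have h1 := hgb _ Set.right_mem_uIcc
    have h2 := hgb _ Set.left_mem_uIcc
    have h3 := norm_sub_le ((g (Real.pi - δ) : ℂ) * E (Real.pi - δ)) ((g δ : ℂ) * E δ)
    have h4 : |τ|⁻¹ * ((4 + 4 * m) / σ) =
        |τ|⁻¹ * (1 / σ) + |τ|⁻¹ * (1 / σ) + |τ|⁻¹ * ((2 + 4 * m) / σ) := by ring
    rw [h4]
    linarith
  have hD : |τ|⁻¹ * ((4 + 4 * m) / σ) ≤ 16 * m * δ := by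
    have h1 : |τ|⁻¹ = δ * δ := by
      rw [inv_eq_iff_eq_inv]; exact eq_inv_of_mul_eq_one_left (by linarith)
    rw [h1, ← mul_div_assoc, div_le_iff₀ hs0]
    have : 16 * m * δ * (δ / 2) ≤ 16 * m * δ * σ := by gcongr
    nlinarith [mul_pos hδ0 hδ0]
  rw [hsplit]
  have h1 := norm_add₃_le (a := ∫ l in (0 : ℝ)..δ, F l) (b := ∫ l in δ..(Real.pi - δ), F l)
    (c := ∫ l in (Real.pi - δ)..Real.pi, F l)
  have : δ ≤ m * δ := le_mul_of_one_le_left hδ0.le hm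
  linarith

/-- The oscillatory integral `∫₀^π e^{-iτ cos λ} sin λ sin(mλ) dλ`. -/
def oscIntegral (τ m : ℝ) : ℂ :=
  ∫ l in (0 : ℝ)..Real.pi, Complex.exp (-Complex.I * τ * Real.cos l) * (Real.sin l : ℂ) *
    (Real.sin (m * l) : ℂ)

lemma norm_oscIntegral_le_pi (τ m : ℝ) : ‖oscIntegral τ m‖ ≤ Real.pi := by
  have := intervalIntegral.norm_integral_le_of_norm_le_const (a := 0) (b := Real.pi) (C := 1)
    (f := fun l : ℝ => Complex.exp (-Complex.I * τ * Real.cos l) * (Real.sin l : ℂ) *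
      (Real.sin (m * l) : ℂ)) fun l _ => by
      have h : -Complex.I * τ * Real.cos l = ((-τ * Real.cos l : ℝ) : ℂ) * Complex.I := by
        push_cast; ring
      rw [norm_mul, norm_mul, h, Complex.norm_exp_ofReal_mul_I, one_mul, Complex.norm_real,
        Complex.norm_real]
      exact mul_le_one₀ (Real.abs_sin_le_one _) (norm_nonneg _) (Real.abs_sin_le_one _)
  simpa [oscIntegral, abs_of_pos Real.pi_pos] using this

lemma oscIntegral_eq {τ : ℝ} (hτ : τ ≠ 0) (m : ℕ) :
    oscIntegral τ m = -((m : ℂ) * (Complex.I * τ)⁻¹) *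
      ∫ l in (0 : ℝ)..Real.pi, Complex.exp (-Complex.I * τ * Real.cos l) *
        (Real.cos (m * l) : ℂ) := by
  have hτC : (τ : ℂ) ≠ 0 := Complex.ofReal_ne_zero.mpr hτ
  have hd : ∀ l ∈ Set.uIcc 0 Real.pi, HasDerivAt
      (fun l : ℝ => (Complex.I * τ)⁻¹ * Complex.exp (-Complex.I * τ * Real.cos l))
      (Complex.exp (-Complex.I * τ * Real.cos l) * (Real.sin l : ℂ)) l := by
    intro l _
    have h1 : HasDerivAt (fun l : ℝ => (Real.cos l : ℂ)) ((-Real.sin l : ℝ) : ℂ) l :=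
      (Real.hasDerivAt_cos l).ofReal_comp
    have h2 := ((h1.const_mul (-Complex.I * (τ : ℂ))).cexp).const_mul (Complex.I * (τ : ℂ))⁻¹
    refine h2.congr_deriv ?_
    push_cast
    field_simp [hτC]
  have hs : ∀ l ∈ Set.uIcc 0 Real.pi, HasDerivAt (fun l : ℝ => (Real.sin (m * l) : ℂ))
      ((m * Real.cos (m * l) : ℝ) : ℂ) l := by
    intro l _
    have h := ((hasDerivAt_id l).const_mul (m : ℝ)).sin
    refine (h.congr_deriv ?_).ofReal_comp
    simp; ring
  have h := intervalIntegral.integral_mul_deriv_eq_deriv_mul hs hd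
    (by apply Continuous.intervalIntegrable; fun_prop)
    (by apply Continuous.intervalIntegrable; fun_prop)
  have h0 : Real.sin (m * Real.pi) = 0 := Real.sin_nat_mul_pi m
  rw [h0, mul_zero, Real.sin_zero, Complex.ofReal_zero, zero_mul, zero_mul, sub_zero,
    zero_sub] at h
  rw [oscIntegral, neg_mul ((m : ℂ) * _), ← intervalIntegral.integral_const_mul]
  calc _ = ∫ l in (0 : ℝ)..Real.pi, (Real.sin (m * l) : ℂ) *
        (Complex.exp (-Complex.I * τ * Real.cos l) * (Real.sin l : ℂ)) :=
        intervalIntegral.integral_congr fun l _ => mul_comm _ _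
    _ = _ := by
        rw [h]
        congr 1
        refine intervalIntegral.integral_congr fun l _ => ?_
        push_cast
        ring

lemma norm_oscIntegral_le {τ : ℝ} (hτ : τ ≠ 0) {m : ℕ} (hm : 1 ≤ m) :
    ‖oscIntegral τ m‖ ≤ 20 * |τ| ^ (-(3 / 2) : ℝ) * (m : ℝ) ^ 2 := by
  have hτ0 : 0 < |τ| := abs_pos.mpr hτ
  have hm' : (1 : ℝ) ≤ m := by exact_mod_cast hm
  rcases le_total 1 |τ| with h1 | h1
  · have h := norm_integral_exp_cos_mul_cos_le h1 hm'
    rw [oscIntegral_eq hτ, norm_mul]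
    have hn : ‖-((m : ℂ) * (Complex.I * τ)⁻¹)‖ = m * |τ|⁻¹ := by simp
    rw [hn]
    calc _ ≤ (m : ℝ) * |τ|⁻¹ * (20 * m * |τ| ^ (-(1 / 2) : ℝ)) := by gcongr
      _ = 20 * (|τ| ^ (-1 : ℝ) * |τ| ^ (-(1 / 2) : ℝ)) * (m : ℝ) ^ 2 := by
        rw [Real.rpow_neg_one]; ring
      _ = _ := by rw [← Real.rpow_add hτ0]; norm_num
  · have h2 : 1 ≤ |τ| ^ (-(3 / 2) : ℝ) :=
      Real.one_le_rpow_of_pos_of_le_one_of_nonpos hτ0 h1 (by norm_num)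
    have h3 : (1 : ℝ) ≤ (m : ℝ) ^ 2 := one_le_pow₀ hm'
    have := norm_oscIntegral_le_pi τ m
    nlinarith [Real.pi_lt_four, mul_le_mul h2 h3 zero_le_one (by linarith)]

/-- The constant in the pointwise bound for the Schrödinger kernel. -/
def schKernelConst (Q : ℕ) : ℝ := ∑' k : ℕ, 4 * (((k : ℝ) + 1) ^ 2 * (Q : ℝ)⁻¹ ^ k)

lemma schKernelConst_nonneg (Q : ℕ) : 0 ≤ schKernelConst Q :=
  tsum_nonneg fun _ => by positivity

lemma norm_schKernel_le {Q : ℕ} (hQ : 2 ≤ Q) {t c : ℝ}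
    (hc : ∀ m : ℕ, 1 ≤ m → ‖oscIntegral (gammaZero Q * t) m‖ ≤ c * (m : ℝ) ^ 2) (n : ℕ) :
    ‖schKernel Q t n‖ ≤ c * schKernelConst Q * radialMajorant Q n := by
  have hc0 : 0 ≤ c := by simpa using (norm_nonneg _).trans (hc 1 le_rfl)
  have hQ1 : (1 : ℝ) < Q := by exact_mod_cast (by omega : 1 < Q)
  have hQ0 : (0 : ℝ) < Q := by linarith
  have hsum : Summable fun k : ℕ => 4 * (((k : ℝ) + 1) ^ 2 * (Q : ℝ)⁻¹ ^ k) := by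
    have := summable_add_one_rpow_mul_geometric (q := 2) (inv_pos.mpr hQ0)
      (inv_lt_one_of_one_lt₀ hQ1)
    simpa using this.mul_left 4
  have hpow : ∀ k : ℕ, (Q : ℝ) ^ (-(n : ℝ) / 2 - (k : ℝ)) =
      (Real.sqrt Q)⁻¹ ^ n * (Q : ℝ)⁻¹ ^ k := by
    intro k
    rw [Real.rpow_sub hQ0, Real.rpow_natCast, Real.sqrt_eq_rpow, ← Real.rpow_neg hQ0.le,
      ← Real.rpow_mul_natCast hQ0.le, inv_pow, div_eq_mul_inv]
    congr 2
    ring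
  have hosc : ∀ k : ℕ, (∫ l in (0 : ℝ)..Real.pi,
        Complex.exp (-Complex.I * (gammaZero Q) * t * Real.cos l) *
          (Real.sin l : ℂ) * (Real.sin (((n : ℝ) + 2 * k + 1) * l) : ℂ)) =
      oscIntegral (gammaZero Q * t) ((n + 2 * k + 1 : ℕ) : ℝ) := by
    intro k
    rw [oscIntegral]
    refine intervalIntegral.integral_congr fun l _ => ?_
    push_cast
    ring_nf
  have hb := tsum_of_norm_bounded (f := fun k : ℕ =>
      (((Q : ℝ) ^ (-(n : ℝ) / 2 - (k : ℝ)) : ℝ) : ℂ) *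
        ∫ l in (0 : ℝ)..Real.pi,
        Complex.exp (-Complex.I * (gammaZero Q) * t * Real.cos l) *
          (Real.sin l : ℂ) * (Real.sin (((n : ℝ) + 2 * k + 1) * l) : ℂ))
    (hsum.hasSum.mul_left (c * radialMajorant Q n)) fun k => by
      rw [hosc, hpow, norm_mul, Complex.norm_real, Real.norm_of_nonneg (by positivity)]
      have hn : (0 : ℝ) ≤ n := Nat.cast_nonneg n
      have hk : (0 : ℝ) ≤ k := Nat.cast_nonneg k
      have hm : ((n + 2 * k + 1 : ℕ) : ℝ) ≤ ((n : ℝ) + 1) * (2 * ((k : ℝ) + 1)) := by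
        push_cast; nlinarith
      calc _ ≤ (Real.sqrt Q)⁻¹ ^ n * (Q : ℝ)⁻¹ ^ k * (c * ((n + 2 * k + 1 : ℕ) : ℝ) ^ 2) := by
            gcongr; exact hc _ (by omega)
        _ ≤ (Real.sqrt Q)⁻¹ ^ n * (Q : ℝ)⁻¹ ^ k *
              (c * (((n : ℝ) + 1) * (2 * ((k : ℝ) + 1))) ^ 2) := by gcongr
        _ = _ := by rw [radialMajorant]; ring
  have hpref : ‖Complex.exp (Complex.I * t) * (2 / Real.pi)‖ ≤ 1 := by
    rw [norm_mul, mul_comm Complex.I, Complex.norm_exp_ofReal_mul_I, one_mul, norm_div,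
      Complex.norm_real, Real.norm_of_nonneg Real.pi_pos.le, div_le_one Real.pi_pos]
    simpa using Real.two_le_pi
  rw [schKernel, norm_mul]
  calc _ ≤ 1 * (c * radialMajorant Q n * ∑' k : ℕ, 4 * (((k : ℝ) + 1) ^ 2 * (Q : ℝ)⁻¹ ^ k)) :=
        mul_le_mul hpref hb (norm_nonneg _) zero_le_one
    _ = _ := by rw [schKernelConst]; ring

lemma enorm_propagate_le {Q : ℕ} (T : HomTree Q) {t A : ℝ} (hA : 0 ≤ A)
    (hk : ∀ n, ‖schKernel Q t n‖ ≤ A * radialMajorant Q n) (f : T.V → ℂ) (x : T.V) :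
    ‖propagate T t f x‖ₑ ≤ ENNReal.ofReal A *
      ∑' y, ENNReal.ofReal (radialMajorant Q (T.graph.dist x y)) * ‖f y‖ₑ := by
  have hk' : ∀ n, ‖schKernel Q t n‖ₑ ≤
      ENNReal.ofReal A * ENNReal.ofReal (radialMajorant Q n) := by
    intro n
    rw [← ofReal_norm, ← ENNReal.ofReal_mul hA]
    exact ENNReal.ofReal_le_ofReal (hk n)
  calc ‖propagate T t f x‖ₑ ≤ ∑' n, ‖schKernel Q t n * sphereSum T f x n‖ₑ :=
        enorm_tsum_le_tsum_enorm
    _ ≤ ∑' n, ∑' y : {y : T.V // T.graph.dist x y = n}, ENNReal.ofReal A *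
          (ENNReal.ofReal (radialMajorant Q (T.graph.dist x y)) * ‖f y‖ₑ) := by
        refine ENNReal.tsum_le_tsum fun n => ?_
        rw [enorm_mul]
        calc _ ≤ ENNReal.ofReal A * ENNReal.ofReal (radialMajorant Q n) *
              ∑' y : {y : T.V // T.graph.dist x y = n}, ‖f y‖ₑ :=
              mul_le_mul' (hk' n) enorm_tsum_le_tsum_enorm
          _ = _ := by
              rw [← ENNReal.tsum_mul_left]
              refine tsum_congr fun y => ?_
              rw [y.2, mul_assoc]
    _ = ∑' y, ENNReal.ofReal A *
          (ENNReal.ofReal (radialMajorant Q (T.graph.dist x y)) * ‖f y‖ₑ) := by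
        rw [← ENNReal.tsum_sigma, ← (Equiv.sigmaFiberEquiv fun y => T.graph.dist x y).tsum_eq]
        rfl
    _ = _ := ENNReal.tsum_mul_left

lemma exists_spaceNorm_le {Q : ℕ} (hQ : 2 ≤ Q) (T : HomTree Q) {q q' : ℝ≥0∞} (hq : 2 < q)
    (hconj : q⁻¹ + q'⁻¹ = 1) :
    ∃ D : ℝ≥0, ∀ (a : ℝ≥0∞) (g f : T.V → ℂ),
      (∀ x, ‖g x‖ₑ ≤ a * ∑' y, ENNReal.ofReal (radialMajorant Q (T.graph.dist x y)) * ‖f y‖ₑ) →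
      spaceNorm T q g ≤ a * D * spaceNorm T q' f := by
  by_cases hqt : q = ∞
  · obtain ⟨B, hB⟩ := exists_radialMajorant_le hQ
    have hq' : q' = 1 := by simpa [hqt] using hconj
    refine ⟨B.toNNReal, fun a g f h => ?_⟩
    simp only [spaceNorm, hqt, hq', if_true, ENNReal.one_ne_top, if_false, ENNReal.toReal_one,
      ENNReal.rpow_one, div_one]
    refine iSup_le fun x => (h x).trans ?_
    rw [mul_assoc, ← ENNReal.tsum_mul_left (a := (B.toNNReal : ℝ≥0∞))]
    gcongr with y
    · exact ENNReal.ofReal_le_ofReal (hB _)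
    · exact le_rfl
  · have hq0 : q ≠ 0 := (zero_le.trans_lt hq).ne'
    have hq't : q' ≠ ∞ := by
      rintro rfl
      rw [ENNReal.inv_top, add_zero, ENNReal.inv_eq_one] at hconj
      rw [hconj] at hq
      exact absurd hq (by norm_num)
    have hq'0 : q' ≠ 0 := by
      rintro rfl
      simp at hconj
    have hqr : 2 < q.toReal := by
      simpa using (ENNReal.toReal_lt_toReal ENNReal.ofNat_ne_top hqt).mpr hq
    have hholder : q.toReal.HolderConjugate q'.toReal := by
      rw [Real.holderConjugate_iff]
      refine ⟨by linarith, ?_⟩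
      rw [← ENNReal.toReal_inv, ← ENNReal.toReal_inv,
        ← ENNReal.toReal_add (ENNReal.inv_ne_top.mpr hq0) (ENNReal.inv_ne_top.mpr hq'0), hconj,
        ENNReal.toReal_one]
    have hM := schurConst_radialMajorant_ne_top hQ hqr
    set M := schurConst Q fun n => ENNReal.ofReal (radialMajorant Q n) ^ (q.toReal / 2)
    have hr0 : 0 < q.toReal := by linarith
    refine ⟨(M ^ (2 / q.toReal)).toNNReal, fun a g f h => ?_⟩
    rw [ENNReal.coe_toNNReal (ENNReal.rpow_ne_top_of_nonneg (by positivity) hM)]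
    simp only [spaceNorm, hqt, hq't, if_false]
    have hmain := tsum_rpow_radial_le hQ T hqr hholder
      (fun n => ENNReal.ofReal (radialMajorant Q n)) fun y => ‖f y‖ₑ
    calc (∑' x, ‖g x‖ₑ ^ q.toReal) ^ (1 / q.toReal)
        ≤ (∑' x, (a * ∑' y, ENNReal.ofReal (radialMajorant Q (T.graph.dist x y)) * ‖f y‖ₑ) ^
            q.toReal) ^ (1 / q.toReal) := by
          gcongr with x
          exact h x
      _ = a * (∑' x, (∑' y, ENNReal.ofReal (radialMajorant Q (T.graph.dist x y)) * ‖f y‖ₑ) ^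
            q.toReal) ^ (1 / q.toReal) := by
          simp only [ENNReal.mul_rpow_of_nonneg _ _ hr0.le]
          rw [ENNReal.tsum_mul_left, ENNReal.mul_rpow_of_nonneg _ _ (by positivity),
            ← ENNReal.rpow_mul, mul_one_div_cancel hr0.ne', ENNReal.rpow_one]
      _ ≤ _ := by
          rw [mul_assoc]
          gcongr
          exact hmain

/-- Dispersive estimate: for `2 < q ≤ ∞` and `q'` the conjugate exponent,
`‖e^{itℒ}f‖_{L^q} ≲ ‖f‖_{L^{q'}}` for `|t| < 1` and
`‖e^{itℒ}f‖_{L^q} ≲ |t|^{-3/2} ‖f‖_{L^{q'}}` for `|t| ≥ 1`. -/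
theorem dispersive_estimate (Q : ℕ) (hQ : 2 ≤ Q) (T : HomTree Q)
    (q q' : ℝ≥0∞) (hq : 2 < q) (hconj : q⁻¹ + q'⁻¹ = 1) :
    ∃ C : ℝ≥0, 0 < C ∧ ∀ (t : ℝ) (f : T.V → ℂ),
      (|t| < 1 → spaceNorm T q (propagate T t f) ≤ (C : ℝ≥0∞) * spaceNorm T q' f) ∧
      (1 ≤ |t| → spaceNorm T q (propagate T t f) ≤
        (C : ℝ≥0∞) * ENNReal.ofReal (|t| ^ (-(3 / 2) : ℝ)) * spaceNorm T q' f) := by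
  obtain ⟨D, hD⟩ := exists_spaceNorm_le hQ T hq hconj
  have hγ : 0 < gammaZero Q := by
    have : (0 : ℝ) < Q := by exact_mod_cast (by omega : 0 < Q)
    unfold gammaZero
    positivity
  have hK := schKernelConst_nonneg Q
  have hest : ∀ (t c : ℝ) (f : T.V → ℂ), 0 ≤ c →
      (∀ m : ℕ, 1 ≤ m → ‖oscIntegral (gammaZero Q * t) m‖ ≤ c * (m : ℝ) ^ 2) →
      spaceNorm T q (propagate T t f) ≤
        ENNReal.ofReal (c * schKernelConst Q) * D * spaceNorm T q' f := fun t c f hc hm =>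
    hD _ _ _ (enorm_propagate_le T (mul_nonneg hc hK) (norm_schKernel_le hQ hm) f)
  set c₀ : ℝ := max Real.pi (20 * gammaZero Q ^ (-(3 / 2) : ℝ)) with hc₀
  have hc₀0 : 0 ≤ c₀ := Real.pi_pos.le.trans (le_max_left _ _)
  refine ⟨(c₀ * schKernelConst Q).toNNReal * D + 1, by positivity, fun t f => ⟨fun _ => ?_,
    fun ht => ?_⟩⟩
  · refine (hest t c₀ f hc₀0 fun m hm => ?_).trans ?_
    · have hm' : (1 : ℝ) ≤ (m : ℝ) ^ 2 := one_le_pow₀ (by exact_mod_cast hm)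
      exact (norm_oscIntegral_le_pi _ _).trans
        ((le_max_left _ _).trans (le_mul_of_one_le_right hc₀0 hm'))
    · gcongr
      push_cast
      exact le_self_add
  · have ht0 : 0 < |t| := by linarith
    have hp : 0 ≤ |t| ^ (-(3 / 2) : ℝ) := by positivity
    refine (hest t (c₀ * |t| ^ (-(3 / 2) : ℝ)) f (by positivity) fun m hm => ?_).trans ?_
    · refine (norm_oscIntegral_le (mul_ne_zero hγ.ne' (abs_pos.mp ht0)) hm).trans ?_
      rw [abs_mul, abs_of_pos hγ, Real.mul_rpow hγ.le ht0.le, ← mul_assoc]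
      gcongr
      exact le_max_right _ _
    · have hsplit : ENNReal.ofReal (c₀ * |t| ^ (-(3 / 2) : ℝ) * schKernelConst Q) * (D : ℝ≥0∞) =
          ENNReal.ofReal (c₀ * schKernelConst Q) * D * ENNReal.ofReal (|t| ^ (-(3 / 2) : ℝ)) := by
        rw [mul_right_comm c₀, ENNReal.ofReal_mul (by positivity), mul_right_comm]
      rw [hsplit]
      gcongr
      push_cast
      exact le_self_add
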